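/- arXiv:2007.07946 — 2 statements merged into one kernel-verified Lean document; each statement's English description precedes it below -/
import Mathlib

section
/- Let (X_t)_{t≥0} be an infinite time horizon Brownian bridge with jointly measurable sample paths whose coefficient α satisfies the growth conditions (i) and (ii), and assume that α(t) ≥ c t^ρ for all t ≥ t₀, for some c > 0, t₀ > 0 and ρ > 1. Then for every μ with 0 < μ < min(ρ/2, 1) and every M > 0, there exist constants C > 0 and ℓ > 1 such that for all sufficiently large t, P( t^{−μ} ∫₁ᵗ α(r) |X_r| dr ≤ M ) ≤ C t^{−ℓ}; consequently lim_{n→∞} n^{−μ} ∫₁ⁿ α(r) |X_r| dr = ∞ almost surely. -/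
open MeasureTheory ProbabilityTheory Real Filter Set

/-- `Aint α t = ∫₀ᵗ α(u) du`. -/
noncomputable def Aint (α : ℝ → ℝ) (t : ℝ) : ℝ := ∫ u in (0:ℝ)..t, α u

/-- `alphaStar α t = sup_{0 ≤ r ≤ t} α(r)`. -/
noncomputable def alphaStar (α : ℝ → ℝ) (t : ℝ) : ℝ := sSup (α '' Set.Icc 0 t)

/-- Covariance kernel of the infinite time horizon Brownian bridge. -/
noncomputable def Kker (α : ℝ → ℝ) (s t : ℝ) : ℝ :=
  Real.exp (-(Aint α s) - Aint α t) * ∫ u in (0:ℝ)..(min s t), Real.exp (2 * Aint α u)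

/-- `X` is an infinite time horizon Brownian bridge associated with coefficient `α`:
every finite real linear combination of the `X_{t_i}` (for `t_i ≥ 0`) is a centered
Gaussian random variable, and the covariance is given by the kernel `Kker α`. -/
def IsBridge {Ω : Type*} [MeasurableSpace Ω] (P : Measure Ω) (α : ℝ → ℝ)
    (X : ℝ → Ω → ℝ) : Prop :=
  (∀ (n : ℕ) (c t : Fin n → ℝ), (∀ i, 0 ≤ t i) →
    ∃ v : NNReal, P.map (fun ω => ∑ i, c i * X (t i) ω) = gaussianReal 0 v) ∧
  (∀ s t : ℝ, 0 ≤ s → 0 ≤ t → ∫ ω, X s ω * X t ω ∂P = Kker α s t)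

/-- Growth conditions (i) and (ii) on `α`, with parameters `γ ∈ [0,1/2]`, `β > 0`. -/
def GrowthCond (α : ℝ → ℝ) (γ β : ℝ) : Prop :=
  ContDiffOn ℝ 1 α (Set.Ici 0) ∧ γ ∈ Set.Icc (0:ℝ) (1/2) ∧ 0 < β ∧
    (∃ C > (0:ℝ), ∀ t > (0:ℝ), (alphaStar α (t+1)) ^ (2*γ) / α t ≤ C * t ^ (-β)) ∧
    (∃ C : ℝ, ∀ t ≥ (0:ℝ), |deriv α t / α t| ≤ C)

/-- The approximating local time `L^x_{t,ε} = ∫₀ᵗ (2πε)^{-1/2} exp(-(X_r - x)²/(2ε)) dr`. -/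
noncomputable def locApprox {Ω : Type*} (X : ℝ → Ω → ℝ) (x ε t : ℝ) (ω : Ω) : ℝ :=
  ∫ r in (0:ℝ)..t, (Real.sqrt (2 * Real.pi * ε))⁻¹ * Real.exp (-(X r ω - x)^2 / (2*ε))

section Deterministic

/-- The integral `∫₀ᵗ exp (k A(u)) du`. -/
noncomputable def expAint (α : ℝ → ℝ) (k t : ℝ) : ℝ := ∫ u in (0:ℝ)..t, exp (k * Aint α u)

lemma Kker_comm (α : ℝ → ℝ) (s t : ℝ) : Kker α s t = Kker α t s := by
  simp only [Kker, min_comm s t]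
  ring_nf

lemma Kker_of_le (α : ℝ → ℝ) {s t : ℝ} (h : s ≤ t) :
    Kker α s t = exp (-(Aint α s)) * exp (-(Aint α t)) * expAint α 2 s := by
  rw [Kker, min_eq_left h, sub_eq_add_neg, exp_add, expAint]

variable {α : ℝ → ℝ}

lemma hasDerivAt_Aint (hα : Continuous α) (t : ℝ) : HasDerivAt (Aint α) (α t) t :=
  intervalIntegral.integral_hasDerivAt_right (hα.intervalIntegrable _ _)
    (hα.stronglyMeasurableAtFilter _ _) hα.continuousAt

lemma continuous_Aint (hα : Continuous α) : Continuous (Aint α) :=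
  continuous_iff_continuousAt.2 fun t => (hasDerivAt_Aint hα t).continuousAt

lemma hasDerivAt_expAint (hα : Continuous α) (k t : ℝ) :
    HasDerivAt (expAint α k) (exp (k * Aint α t)) t := by
  have := continuous_Aint hα
  have hc : Continuous fun u => exp (k * Aint α u) := by fun_prop
  exact intervalIntegral.integral_hasDerivAt_right (hc.intervalIntegrable _ _)
    (hc.stronglyMeasurableAtFilter _ _) hc.continuousAt

lemma continuous_expAint (hα : Continuous α) (k : ℝ) : Continuous (expAint α k) :=
  continuous_iff_continuousAt.2 fun t => (hasDerivAt_expAint hα k t).continuousAt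

lemma continuous_Kker (hα : Continuous α) : Continuous fun z : ℝ × ℝ => Kker α z.1 z.2 := by
  have h1 := continuous_Aint hα
  have h2 := continuous_expAint hα 2
  have : Continuous fun z : ℝ × ℝ =>
      exp (-(Aint α z.1) - Aint α z.2) * expAint α 2 (min z.1 z.2) := by fun_prop
  exact this

lemma continuous_Kker_self (hα : Continuous α) : Continuous fun r => Kker α r r :=
  (continuous_Kker hα).comp (by fun_prop : Continuous fun r : ℝ => (r, r))

lemma monotone_Aint (hα : Continuous α) (hpos : ∀ t, 0 < α t) : Monotone (Aint α) :=
  monotone_of_hasDerivAt_nonneg (hasDerivAt_Aint hα) fun t => (hpos t).le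

lemma expAint_nonneg (α : ℝ → ℝ) (k : ℝ) {t : ℝ} (ht : 0 ≤ t) : 0 ≤ expAint α k t :=
  intervalIntegral.integral_nonneg ht fun _ _ => (exp_pos _).le

lemma expAint_pos (hα : Continuous α) (k : ℝ) {t : ℝ} (ht : 0 < t) : 0 < expAint α k t := by
  have := continuous_Aint hα
  exact intervalIntegral.intervalIntegral_pos_of_pos
    ((by fun_prop : Continuous fun u => exp (k * Aint α u)).intervalIntegrable _ _)
    (fun _ => exp_pos _) ht

lemma expAint_le (hα : Continuous α) (hpos : ∀ t, 0 < α t) {k t : ℝ} (hk : 0 ≤ k)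
    (ht : 0 ≤ t) : expAint α k t ≤ t * exp (k * Aint α t) := by
  have hA := continuous_Aint hα
  have : expAint α k t ≤ ∫ _ in (0:ℝ)..t, exp (k * Aint α t) := by
    refine intervalIntegral.integral_mono_on ht
      ((by fun_prop : Continuous fun u => exp (k * Aint α u)).intervalIntegrable _ _)
      (by simp) fun u hu => ?_
    have := monotone_Aint hα hpos hu.2
    gcongr
  simpa using this

lemma expAint_two_le (hα : Continuous α) (hpos : ∀ t, 0 < α t) {t : ℝ} (ht : 0 ≤ t) :
    exp (-(Aint α t)) * expAint α 2 t ≤ expAint α 1 t := by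
  have hA := continuous_Aint hα
  rw [expAint, expAint, ← intervalIntegral.integral_const_mul]
  refine intervalIntegral.integral_mono_on ht
    ((by fun_prop : Continuous fun u => exp (-(Aint α t)) * exp (2 * Aint α u)).intervalIntegrable
      _ _)
    ((by fun_prop : Continuous fun u => exp (1 * Aint α u)).intervalIntegrable _ _) fun u hu => ?_
  rw [← exp_add]
  have := monotone_Aint hα hpos hu.2
  gcongr
  linarith

lemma Kker_nonneg (α : ℝ → ℝ) {s t : ℝ} (hs : 0 ≤ s) (ht : 0 ≤ t) : 0 ≤ Kker α s t :=
  mul_nonneg (exp_pos _).le (expAint_nonneg α 2 (le_min hs ht))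

lemma Kker_self_pos (hα : Continuous α) {t : ℝ} (ht : 0 < t) : 0 < Kker α t t := by
  have := expAint_pos hα 2 ht
  rw [Kker_of_le α le_rfl]
  positivity

lemma hasDerivAt_Kker_self (hα : Continuous α) (t : ℝ) :
    HasDerivAt (fun t => Kker α t t) (1 - 2 * (α t * Kker α t t)) t := by
  have hA := (hasDerivAt_Aint hα t).neg.exp
  have h := (hA.mul hA).mul (hasDerivAt_expAint hα 2 t)
  have e : (fun t => Kker α t t) =
      (fun t => exp ((-Aint α) t)) * (fun t => exp ((-Aint α) t)) * expAint α 2 := by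
    ext s; simp [Kker_of_le α le_rfl]
  rw [e]
  refine h.congr_deriv ?_
  have : exp (-Aint α t) * exp (-Aint α t) * exp (2 * Aint α t) = 1 := by
    rw [← exp_add, ← exp_add]; ring_nf; simp
  rw [Kker_of_le α le_rfl]
  simp only [Pi.mul_apply, Pi.neg_apply]
  linear_combination this

lemma integral_mul_Kker_self (hα : Continuous α) (a b : ℝ) :
    ∫ r in a..b, α r * Kker α r r = (b - a - (Kker α b b - Kker α a a)) / 2 := by
  have hK := continuous_Kker_self hα
  have h := intervalIntegral.integral_eq_sub_of_hasDerivAt (a := a) (b := b)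
    (fun t _ => hasDerivAt_Kker_self hα t)
    ((by fun_prop : Continuous fun r => 1 - 2 * (α r * Kker α r r)).intervalIntegrable a b)
  rw [intervalIntegral.integral_sub (by simp)
    ((by fun_prop : Continuous fun r => 2 * (α r * Kker α r r)).intervalIntegrable a b),
    intervalIntegral.integral_const_mul, intervalIntegral.integral_const] at h
  simp only [smul_eq_mul, mul_one] at h
  linarith

/-- If `α` grows at least linearly, then the variance `K(t,t)` is `O(1/t)`. -/
lemma exists_Kker_self_le (hα : Continuous α) (hpos : ∀ t, 0 < α t) {c t₀ : ℝ} (hc : 0 < c)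
    (hlb : ∀ t ≥ t₀, c * t ≤ α t) :
    ∃ C > 0, ∃ T ≥ 1, ∀ t ≥ T, Kker α t t ≤ C / t := by
  set T := max t₀ 1
  set C := max (1 / c) (T * expAint α 2 T)
  have hT1 : 1 ≤ T := le_max_right _ _
  have hC : 0 < C := lt_of_lt_of_le (by positivity) (le_max_left _ _)
  refine ⟨C, hC, T, hT1, fun t ht => ?_⟩
  have hcC : 1 ≤ c * C := by
    have : c * (1 / c) ≤ c * C := by gcongr; exact le_max_left _ _
    rwa [mul_one_div_cancel hc.ne'] at this
  let h : ℝ → ℝ := fun t => C * exp (2 * Aint α t) - t * expAint α 2 t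
  have hder : ∀ t, HasDerivAt h (C * (exp (2 * Aint α t) * (2 * α t)) -
      (1 * expAint α 2 t + t * exp (2 * Aint α t))) t := fun t =>
    (((hasDerivAt_Aint hα t).const_mul 2).exp.const_mul C).sub
      ((hasDerivAt_id t).mul (hasDerivAt_expAint hα 2 t))
  have hmono : MonotoneOn h (Ici T) := by
    refine monotoneOn_of_hasDerivWithinAt_nonneg (convex_Ici T)
      (fun t _ => (hder t).continuousAt.continuousWithinAt)
      (fun t _ => (hder t).hasDerivWithinAt) fun t ht => ?_
    rw [interior_Ici, mem_Ioi] at ht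
    have ht0 : 0 < t := by linarith
    have h1 := expAint_le hα hpos (k := 2) (by norm_num) ht0.le
    have h2 := hlb t ((le_max_left _ _).trans ht.le)
    have h3 : t ≤ C * α t := by nlinarith
    have := exp_pos (2 * Aint α t)
    nlinarith
  have h0 : 0 ≤ h T := by
    have h1 : T * expAint α 2 T ≤ C := le_max_right _ _
    have h2 : 1 ≤ exp (2 * Aint α T) := by
      rw [one_le_exp_iff]
      have := monotone_Aint hα hpos (zero_le_one.trans hT1)
      simp only [Aint, intervalIntegral.integral_same] at this ⊢
      linarith
    simp only [h]
    nlinarith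
  have h1 : 0 ≤ h t := h0.trans (hmono self_mem_Ici ht ht)
  simp only [h] at h1
  have ht0 : 0 < t := by linarith
  rw [Kker_of_le α le_rfl, le_div_iff₀ ht0]
  have e : exp (-Aint α t) * exp (-Aint α t) * exp (2 * Aint α t) = 1 := by
    rw [← exp_add, ← exp_add]; ring_nf; simp
  have h2 : 0 ≤ exp (-Aint α t) * exp (-Aint α t) *
      (C * exp (2 * Aint α t) - t * expAint α 2 t) := by positivity
  nlinarith

lemma integral_mul_Kker_le (hα : Continuous α) (hpos : ∀ t, 0 < α t) {r t : ℝ} (hr : 1 ≤ r)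
    (hrt : r ≤ t) :
    ∫ s in (1:ℝ)..t, α s * Kker α r s ≤ exp (-(Aint α r)) * expAint α 1 r := by
  have hA := continuous_Aint hα
  have hI := continuous_expAint hα 2
  have hK : Continuous fun s => α s * Kker α r s :=
    hα.mul ((continuous_Kker hα).comp (by fun_prop : Continuous fun s : ℝ => (r, s)))
  rw [← intervalIntegral.integral_add_adjacent_intervals (hK.intervalIntegrable 1 r)
    (hK.intervalIntegrable r t)]
  have hAr := exp_pos (-(Aint α r))
  have hIr := expAint_nonneg α 2 (zero_le_one.trans hr)
  have d1 : ∀ s, HasDerivAt (fun s => expAint α 1 s - exp (-(Aint α s)) * expAint α 2 s)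
      (α s * (exp (-(Aint α s)) * expAint α 2 s)) s := fun s => by
    refine ((hasDerivAt_expAint hα 1 s).sub
      ((hasDerivAt_Aint hα s).neg.exp.mul (hasDerivAt_expAint hα 2 s))).congr_deriv ?_
    have : exp (-Aint α s) * exp (2 * Aint α s) = exp (1 * Aint α s) := by
      rw [← exp_add]; ring_nf
    linear_combination -this
  have i1 : ∫ s in (1:ℝ)..r, α s * Kker α r s = exp (-(Aint α r)) *
      ((expAint α 1 r - exp (-(Aint α r)) * expAint α 2 r) -
        (expAint α 1 1 - exp (-(Aint α 1)) * expAint α 2 1)) := by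
    rw [← intervalIntegral.integral_eq_sub_of_hasDerivAt (fun s _ => d1 s)
      ((by fun_prop : Continuous _).intervalIntegrable _ _),
      ← intervalIntegral.integral_const_mul]
    refine intervalIntegral.integral_congr fun s hs => ?_
    rw [uIcc_of_le hr] at hs
    simp only [Kker_comm α r s, Kker_of_le α hs.2]
    ring
  have d2 : ∀ s, HasDerivAt (fun s => -exp (-(Aint α s))) (α s * exp (-(Aint α s))) s :=
    fun s => by
      refine (hasDerivAt_Aint hα s).neg.exp.neg.congr_deriv ?_
      rw [Pi.neg_apply]
      ring
  have i2 : ∫ s in r..t, α s * Kker α r s = exp (-(Aint α r)) * expAint α 2 r *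
      (-exp (-(Aint α t)) - -exp (-(Aint α r))) := by
    rw [← intervalIntegral.integral_eq_sub_of_hasDerivAt (fun s _ => d2 s)
      ((by fun_prop : Continuous _).intervalIntegrable _ _),
      ← intervalIntegral.integral_const_mul]
    refine intervalIntegral.integral_congr fun s hs => ?_
    rw [uIcc_of_le hrt] at hs
    simp only [Kker_of_le α hs.1]
    ring
  rw [i1, i2]
  have h1 := expAint_two_le hα hpos zero_le_one
  have h2 := exp_pos (-(Aint α t))
  have h3 := mul_nonneg hAr.le (sub_nonneg.2 h1)
  have h4 : 0 ≤ exp (-(Aint α r)) * expAint α 2 r * exp (-(Aint α t)) := by positivity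
  nlinarith

/-- The variance of `∫₁ᵗ α(r) X_r dr` is at most `t`. -/
lemma integral_integral_mul_Kker_le (hα : Continuous α) (hpos : ∀ t, 0 < α t) {t : ℝ}
    (ht : 1 ≤ t) :
    ∫ r in (1:ℝ)..t, ∫ s in (1:ℝ)..t, α r * α s * Kker α r s ≤ t := by
  have hA := continuous_Aint hα
  have hJ := continuous_expAint hα 1
  have hK : Continuous fun z : ℝ × ℝ => α z.1 * α z.2 * Kker α z.1 z.2 := by
    have := continuous_Kker hα
    fun_prop
  have d : ∀ s, HasDerivAt (fun s => exp (-(Aint α s)) * expAint α 1 s)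
      (1 - α s * (exp (-(Aint α s)) * expAint α 1 s)) s := fun s => by
    refine ((hasDerivAt_Aint hα s).neg.exp.mul (hasDerivAt_expAint hα 1 s)).congr_deriv ?_
    have : exp (-Aint α s) * exp (1 * Aint α s) = 1 := by
      rw [← exp_add]; ring_nf; simp
    linear_combination this
  have hcU : Continuous fun s => α s * (exp (-(Aint α s)) * expAint α 1 s) := by fun_prop
  have h1 : ∫ r in (1:ℝ)..t, ∫ s in (1:ℝ)..t, α r * α s * Kker α r s ≤
      ∫ r in (1:ℝ)..t, α r * (exp (-(Aint α r)) * expAint α 1 r) := by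
    refine intervalIntegral.integral_mono_on ht
      ((intervalIntegral.continuous_parametric_intervalIntegral_of_continuous' hK 1
        t).intervalIntegrable _ _) (hcU.intervalIntegrable _ _) fun r hr => ?_
    simp only [mul_assoc, intervalIntegral.integral_const_mul]
    exact mul_le_mul_of_nonneg_left (integral_mul_Kker_le hα hpos hr.1 hr.2) (hpos r).le
  have h2 := intervalIntegral.integral_eq_sub_of_hasDerivAt (fun s _ => d s)
    ((continuous_const.sub hcU).intervalIntegrable 1 t)
  rw [intervalIntegral.integral_sub (by simp) (hcU.intervalIntegrable _ _),
    intervalIntegral.integral_const] at h2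
  have h3 : exp (-(Aint α 1)) * expAint α 1 1 ≤ 1 := by
    have h := mul_le_mul_of_nonneg_left (expAint_le hα hpos (k := 1) zero_le_one zero_le_one)
      (exp_pos (-(Aint α 1))).le
    rwa [one_mul, one_mul, ← exp_add, neg_add_cancel, exp_zero] at h
  have h4 := mul_nonneg (exp_pos (-(Aint α t))).le (expAint_nonneg α 1 (zero_le_one.trans ht))
  simp only [smul_eq_mul, mul_one] at h2
  linarith

/-- Lower bound of order `t ^ (3/2)` for `∫₁ᵗ α(r) √K(r,r) dr`. -/
lemma exists_le_integral_mul_sqrt_Kker (hα : Continuous α) (hpos : ∀ t, 0 < α t) {c t₀ : ℝ}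
    (hc : 0 < c) (hlb : ∀ t ≥ t₀, c * t ≤ α t) :
    ∃ κ > 0, ∃ T ≥ 1, ∀ t ≥ T, κ * (t * √t) ≤ ∫ r in (1:ℝ)..t, α r * √(Kker α r r) := by
  obtain ⟨C, hC, T, hT1, hT⟩ := exists_Kker_self_le hα hpos hc hlb
  have hK := continuous_Kker_self hα
  refine ⟨(√2)⁻¹ * (√C)⁻¹ / 8, by positivity, max (2 * T) (4 * C), ?_, fun t ht => ?_⟩
  · exact le_max_of_le_left (by linarith)
  have ht1 : 2 * T ≤ t := (le_max_left _ _).trans ht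
  have ht2 : 4 * C ≤ t := (le_max_right _ _).trans ht
  have ht0 : 0 < t := by linarith
  have hint : ∀ a b, IntervalIntegrable (fun r => α r * √(Kker α r r)) volume a b := fun a b =>
    (by fun_prop : Continuous _).intervalIntegrable a b
  have h1 : ∫ r in (t/2)..t, α r * √(Kker α r r) ≤ ∫ r in (1:ℝ)..t, α r * √(Kker α r r) := by
    rw [← intervalIntegral.integral_add_adjacent_intervals (hint 1 (t/2)) (hint (t/2) t)]
    have : 0 ≤ ∫ r in (1:ℝ)..(t/2), α r * √(Kker α r r) :=
      intervalIntegral.integral_nonneg (by linarith) fun r _ =>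
        mul_nonneg (hpos r).le (sqrt_nonneg _)
    linarith
  have h2 : ∫ r in (t/2)..t, √(t/2) / √C * (α r * Kker α r r) ≤
      ∫ r in (t/2)..t, α r * √(Kker α r r) := by
    refine intervalIntegral.integral_mono_on (by linarith)
      ((by fun_prop : Continuous _).intervalIntegrable _ _) (hint _ _) fun r hr => ?_
    have hr0 : 0 < r := by linarith [hr.1]
    have hk := hT r (by linarith [hr.1])
    have hk' : √(t/2) * √(Kker α r r) ≤ √C := by
      rw [← sqrt_mul (by positivity)]
      refine sqrt_le_sqrt ?_
      rw [le_div_iff₀ hr0] at hk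
      have := Kker_nonneg α hr0.le hr0.le
      nlinarith [hr.1]
    have hs := sqrt_nonneg (Kker α r r)
    have hss := mul_self_sqrt (Kker_nonneg α hr0.le hr0.le)
    have hp := hpos r
    have hsC : 0 < √C := sqrt_pos.2 hC
    rw [div_mul_eq_mul_div, div_le_iff₀ hsC]
    calc √(t/2) * (α r * Kker α r r)
        = α r * √(Kker α r r) * (√(t/2) * √(Kker α r r)) := by
          linear_combination (-(√(t/2) * α r)) * hss
      _ ≤ α r * √(Kker α r r) * √C := by gcongr
  rw [intervalIntegral.integral_const_mul, integral_mul_Kker_self hα] at h2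
  have h3 : Kker α t t ≤ 1 / 4 := (hT t (by linarith)).trans (by
    rw [div_le_div_iff₀ ht0 (by norm_num)]; linarith)
  have h4 := Kker_nonneg α (s := t/2) (t := t/2) (by positivity) (by positivity)
  refine le_trans ?_ (h2.trans h1)
  have h5 : √(t/2) = √t * (√2)⁻¹ := by rw [sqrt_div ht0.le]; rfl
  calc (√2)⁻¹ * (√C)⁻¹ / 8 * (t * √t) = √(t/2) / √C * (t / 8) := by rw [h5]; ring
    _ ≤ _ := mul_le_mul_of_nonneg_left (by linarith) (by positivity)

end Deterministic

section SecondMoment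

variable {T Ω : Type*} [MeasurableSpace T] [MeasurableSpace Ω] {ν : Measure T} {P : Measure Ω}
  [SFinite ν] [SFinite P]

/-- Bound on the second moment of an integral of a nonnegative process with respect to time. -/
lemma integrable_sq_integral_and_le {f : T → Ω → ℝ} (hf : Measurable (Function.uncurry f))
    (hf0 : ∀ r ω, 0 ≤ f r ω) {B : T × T → ℝ} (hB : Integrable B (ν.prod ν))
    (hint : ∀ᵐ z ∂ν.prod ν, Integrable (fun ω => f z.1 ω * f z.2 ω) P)
    (hle : ∀ᵐ z ∂ν.prod ν, ∫ ω, f z.1 ω * f z.2 ω ∂P ≤ B z) :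
    Integrable (fun ω => (∫ r, f r ω ∂ν) ^ 2) P ∧
      ∫ ω, (∫ r, f r ω ∂ν) ^ 2 ∂P ≤ ∫ z, B z ∂ν.prod ν := by
  have hm : Measurable fun p : (T × T) × Ω => f p.1.1 p.2 * f p.1.2 p.2 :=
    (hf.comp (by fun_prop : Measurable fun p : (T × T) × Ω => (p.1.1, p.2))).mul
      (hf.comp (by fun_prop : Measurable fun p : (T × T) × Ω => (p.1.2, p.2)))
  have hnorm : ∀ z : T × T, ∀ ω, ‖f z.1 ω * f z.2 ω‖ = f z.1 ω * f z.2 ω := fun z ω =>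
    norm_of_nonneg (mul_nonneg (hf0 _ _) (hf0 _ _))
  have hE : Integrable (fun z : T × T => ∫ ω, f z.1 ω * f z.2 ω ∂P) (ν.prod ν) := by
    refine hB.mono' hm.stronglyMeasurable.integral_prod_right'.aestronglyMeasurable ?_
    filter_upwards [hle] with z hz
    rwa [norm_of_nonneg (integral_nonneg fun ω => mul_nonneg (hf0 _ _) (hf0 _ _))]
  have hI : Integrable (fun p : (T × T) × Ω => f p.1.1 p.2 * f p.1.2 p.2)
      ((ν.prod ν).prod P) := by
    refine (integrable_prod_iff hm.aestronglyMeasurable).2 ⟨hint, ?_⟩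
    simpa only [hnorm] using hE
  have hsq : ∀ ω, ∫ z : T × T, f z.1 ω * f z.2 ω ∂ν.prod ν = (∫ r, f r ω ∂ν) ^ 2 := fun ω => by
    rw [integral_prod_mul (fun r => f r ω) (fun r => f r ω), sq]
  refine ⟨by simpa only [hsq] using hI.integral_prod_right, ?_⟩
  calc ∫ ω, (∫ r, f r ω ∂ν) ^ 2 ∂P
      = ∫ ω, ∫ z : T × T, f z.1 ω * f z.2 ω ∂ν.prod ν ∂P := by simp only [hsq]
    _ = ∫ z : T × T, ∫ ω, f z.1 ω * f z.2 ω ∂P ∂ν.prod ν := by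
        rw [← integral_prod_symm _ hI, integral_prod _ hI]
    _ ≤ ∫ z, B z ∂ν.prod ν := integral_mono_ae hE hB hle

end SecondMoment

section Gaussian

/-- The first absolute moment of the standard Gaussian. -/
noncomputable def gaussianAbsMoment : ℝ := ∫ x, |x| ∂gaussianReal 0 1

lemma gaussianAbsMoment_pos : 0 < gaussianAbsMoment := by
  have hi : Integrable (fun x : ℝ => |x|) (gaussianReal 0 1) :=
    ((memLp_id_gaussianReal 1).integrable le_rfl).abs
  refine (integral_pos_iff_support_of_nonneg (fun x => abs_nonneg x) hi).2 ?_
  have hsupp : Function.support (fun x : ℝ => |x|) = {0}ᶜ := by ext; simp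
  have := nullSingletonClass_gaussianReal (μ := 0) one_ne_zero
  rw [hsupp, prob_compl_eq_one_sub (measurableSet_singleton 0)]
  simp

variable {Ω : Type*} [MeasurableSpace Ω] {P : Measure Ω}

lemma integral_abs_gaussianReal (v : NNReal) :
    ∫ x, |x| ∂gaussianReal 0 v = √(v:ℝ) * gaussianAbsMoment := by
  have h := gaussianReal_map_const_mul (μ := 0) (v := 1) (√(v:ℝ))
  have e : NNReal.mk (√(v:ℝ) ^ 2) (sq_nonneg _) * 1 = v := by
    ext; simp
  rw [mul_zero, e] at h
  rw [← h, integral_map (by fun_prop) (by fun_prop), gaussianAbsMoment, ← integral_const_mul]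
  simp [abs_mul, abs_of_nonneg]

lemma integral_abs_of_hasGaussianLaw {Z : Ω → ℝ} (hZ : HasGaussianLaw Z P) (h0 : P[Z] = 0) :
    ∫ ω, |Z ω| ∂P = √(∫ ω, Z ω ^ 2 ∂P) * gaussianAbsMoment := by
  have h := integral_map (f := fun x : ℝ => |x|) hZ.aemeasurable (by fun_prop)
  rw [← h, hZ.map_eq_gaussianReal, h0, integral_abs_gaussianReal,
    variance_of_integral_eq_zero hZ.aemeasurable h0,
    coe_toNNReal _ (integral_nonneg fun ω => sq_nonneg _)]

/-- For centered jointly Gaussian `X` and `Y`, `Cov(|X|, |Y|) ≤ |Cov(X, Y)|`. -/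
lemma integral_abs_mul_abs_le {X Y : Ω → ℝ} (h : HasGaussianLaw (fun ω => (X ω, Y ω)) P)
    (hX0 : P[X] = 0) (hY0 : P[Y] = 0) (hX : 0 < ∫ ω, X ω ^ 2 ∂P) :
    ∫ ω, |X ω| * |Y ω| ∂P ≤
      (∫ ω, |X ω| ∂P) * (∫ ω, |Y ω| ∂P) + |∫ ω, X ω * Y ω ∂P| := by
  have hP := h.isProbabilityMeasure
  set V := ∫ ω, X ω ^ 2 ∂P with hV
  set k := ∫ ω, X ω * Y ω ∂P with hk
  set a := k / V with ha
  let Z : Ω → ℝ := fun ω => Y ω - a * X ω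
  have hXZ : HasGaussianLaw (fun ω => (X ω, Z ω)) P :=
    h.map_fun ((ContinuousLinearMap.fst ℝ ℝ ℝ).prod
      (ContinuousLinearMap.snd ℝ ℝ ℝ - a • ContinuousLinearMap.fst ℝ ℝ ℝ))
  have mX := h.fst.memLp_two
  have mY := h.snd.memLp_two
  have mZ := hXZ.snd.memLp_two
  have iX := h.fst.integrable
  have iY := h.snd.integrable
  have iXY : Integrable (fun ω => X ω * Y ω) P := mX.integrable_mul mY
  have iXX : Integrable (fun ω => X ω ^ 2) P := mX.integrable_sq
  have iYY : Integrable (fun ω => Y ω ^ 2) P := mY.integrable_sq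
  have hZ0 : P[Z] = 0 := by
    simp only [Z]
    rw [integral_sub iY (iX.const_mul a), integral_const_mul, hX0, hY0]; simp
  have hcov : cov[X, Z; P] = 0 := by
    rw [covariance_eq_sub mX mZ, hX0, zero_mul, sub_zero]
    have : (X * Z) = fun ω => X ω * Y ω - a * X ω ^ 2 := by ext ω; simp [Z]; ring
    rw [this, integral_sub iXY (iXX.const_mul a), integral_const_mul, ← hV, ← hk, ha,
      div_mul_cancel₀ _ hX.ne', sub_self]
  have hind := hXZ.indepFun_of_covariance_eq_zero hcov
  have hZZ : ∫ ω, Z ω ^ 2 ∂P ≤ ∫ ω, Y ω ^ 2 ∂P := by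
    have : (fun ω => Z ω ^ 2) = fun ω => Y ω ^ 2 - (2 * a * (X ω * Y ω) - a ^ 2 * X ω ^ 2) := by
      ext ω; simp only [Z]; ring
    have hi : Integrable (fun ω => 2 * a * (X ω * Y ω) - a ^ 2 * X ω ^ 2) P :=
      (iXY.const_mul _).sub (iXX.const_mul _)
    rw [this, integral_sub iYY hi,
      integral_sub (iXY.const_mul _) (iXX.const_mul _), integral_const_mul, integral_const_mul,
      ← hV, ← hk]
    have : 2 * a * k - a ^ 2 * V = k ^ 2 / V := by rw [ha]; field_simp; ring
    rw [this]
    have : 0 ≤ k ^ 2 / V := by positivity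
    linarith
  have hZY : ∫ ω, |Z ω| ∂P ≤ ∫ ω, |Y ω| ∂P := by
    rw [integral_abs_of_hasGaussianLaw hXZ.snd hZ0, integral_abs_of_hasGaussianLaw h.snd hY0]
    exact mul_le_mul_of_nonneg_right (sqrt_le_sqrt hZZ) gaussianAbsMoment_pos.le
  have hmul : ∫ ω, |X ω| * |Z ω| ∂P = (∫ ω, |X ω| ∂P) * ∫ ω, |Z ω| ∂P :=
    (hind.comp measurable_abs measurable_abs).integral_fun_mul_eq_mul_integral
      iX.abs.aestronglyMeasurable hXZ.snd.integrable.abs.aestronglyMeasurable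
  have iXZ : Integrable (fun ω => |X ω| * |Z ω|) P := mX.abs.integrable_mul mZ.abs
  calc ∫ ω, |X ω| * |Y ω| ∂P
      ≤ ∫ ω, (|X ω| * |Z ω| + |a| * X ω ^ 2) ∂P := by
        refine integral_mono (mX.abs.integrable_mul mY.abs) (iXZ.add (iXX.const_mul _))
          fun ω => ?_
        have h1 : |Y ω| ≤ |Z ω| + |a| * |X ω| := by
          rw [← abs_mul]
          calc |Y ω| = |Z ω + a * X ω| := by simp [Z]
            _ ≤ _ := abs_add_le _ _
        have h2 := mul_le_mul_of_nonneg_left h1 (abs_nonneg (X ω))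
        simp only
        rw [← sq_abs (X ω)]
        linarith
    _ = (∫ ω, |X ω| ∂P) * (∫ ω, |Z ω| ∂P) + |k| := by
        rw [integral_add iXZ (iXX.const_mul _), hmul, integral_const_mul, ← hV, ha, abs_div,
          abs_of_pos hX, div_mul_cancel₀ _ hX.ne']
    _ ≤ _ := by gcongr

end Gaussian

section Bridge

variable {Ω : Type*} [MeasurableSpace Ω] {P : Measure Ω} {α : ℝ → ℝ} {X : ℝ → Ω → ℝ}

lemma IsBridge.hasGaussianLaw_pair (hX : IsBridge P α X) (hm : ∀ t, Measurable (X t)) {s t : ℝ}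
    (hs : 0 ≤ s) (ht : 0 ≤ t) : HasGaussianLaw (fun ω => (X s ω, X t ω)) P where
  isGaussian_map := by
    refine isGaussian_of_map_eq_gaussianReal fun L => ⟨0, ?_⟩
    obtain ⟨v, hv⟩ := hX.1 2 ![L (1, 0), L (0, 1)] ![s, t] (by
      intro i; fin_cases i <;> simp [hs, ht])
    refine ⟨v, ?_⟩
    rw [← hv, Measure.map_map (by fun_prop) ((hm s).prodMk (hm t))]
    congr 1
    ext ω
    have : (X s ω, X t ω) = X s ω • ((1:ℝ), (0:ℝ)) + X t ω • ((0:ℝ), (1:ℝ)) := by simp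
    simp only [Function.comp, this, map_add, map_smul]
    simp [Fin.sum_univ_two, mul_comm]

lemma IsBridge.integral_eq_zero (hX : IsBridge P α X) (hm : ∀ t, Measurable (X t)) {t : ℝ}
    (ht : 0 ≤ t) : P[X t] = 0 := by
  obtain ⟨v, hv⟩ := hX.1 1 ![1] ![t] (by simp [ht])
  have h := integral_map (μ := P) (f := fun x : ℝ => x) (hm t).aemeasurable (by fun_prop)
  simp only [Fin.sum_univ_one, Matrix.cons_val_zero, one_mul] at hv
  have hv' : P.map (X t) = gaussianReal 0 v := hv
  rw [← h, hv', integral_id_gaussianReal]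

lemma IsBridge.integral_abs (hX : IsBridge P α X) (hm : ∀ t, Measurable (X t)) {t : ℝ}
    (ht : 0 ≤ t) : ∫ ω, |X t ω| ∂P = √(Kker α t t) * gaussianAbsMoment := by
  rw [integral_abs_of_hasGaussianLaw (hX.hasGaussianLaw_pair hm ht ht).fst
    (hX.integral_eq_zero hm ht), ← hX.2 t t ht ht]
  simp only [sq]

lemma IsBridge.integral_abs_mul_abs_le (hX : IsBridge P α X) (hm : ∀ t, Measurable (X t))
    (hα : Continuous α) {s t : ℝ} (hs : 0 < s) (ht : 0 ≤ t) :
    ∫ ω, |X s ω| * |X t ω| ∂P ≤ √(Kker α s s) * gaussianAbsMoment *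
      (√(Kker α t t) * gaussianAbsMoment) + Kker α s t := by
  have h := _root_.integral_abs_mul_abs_le (hX.hasGaussianLaw_pair hm hs.le ht)
    (hX.integral_eq_zero hm hs.le) (hX.integral_eq_zero hm ht) (by
      simp only [sq]
      rw [hX.2 s s hs.le hs.le]
      exact Kker_self_pos hα hs)
  rwa [hX.integral_abs hm hs.le, hX.integral_abs hm ht, hX.2 s t hs.le ht,
    abs_of_nonneg (Kker_nonneg α hs.le ht)] at h

/-- The weighted integral `∫₁ᵗ α(r) |X_r| dr` is square integrable with variance at most `t`. -/
lemma IsBridge.moments_integral_abs [IsProbabilityMeasure P] (hX : IsBridge P α X)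
    (hm : Measurable (Function.uncurry X)) (hα : Continuous α) (hpos : ∀ t, 0 < α t) {t : ℝ}
    (ht : 1 ≤ t) :
    MemLp (fun ω => ∫ r in (1:ℝ)..t, α r * |X r ω|) 2 P ∧
      ∫ ω, (∫ r in (1:ℝ)..t, α r * |X r ω|) ∂P =
        gaussianAbsMoment * ∫ r in (1:ℝ)..t, α r * √(Kker α r r) ∧
      Var[fun ω => ∫ r in (1:ℝ)..t, α r * |X r ω|; P] ≤ t := by
  have hmt : ∀ t, Measurable (X t) := fun t => hm.comp (by fun_prop : Measurable fun ω => (t, ω))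
  let f : ℝ → Ω → ℝ := fun r ω => α r * |X r ω|
  have hf : Measurable (Function.uncurry f) :=
    (hα.measurable.comp measurable_fst).mul (measurable_abs.comp hm)
  have hf0 : ∀ r ω, 0 ≤ f r ω := fun r ω => mul_nonneg (hpos r).le (abs_nonneg _)
  let ν : Measure ℝ := volume.restrict (Ioc 1 t)
  let Y : Ω → ℝ := fun ω => ∫ r, f r ω ∂ν
  have hYeq : (fun ω => ∫ r in (1:ℝ)..t, α r * |X r ω|) = Y := by
    ext ω; exact intervalIntegral.integral_of_le ht
  have hKc := continuous_Kker_self hα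
  have hint : ∀ r, 0 ≤ r → Integrable (f r) P := fun r hr =>
    ((hX.hasGaussianLaw_pair hmt hr hr).fst.integrable.abs).const_mul _
  have hEf : ∀ r, 0 ≤ r → ∫ ω, f r ω ∂P = gaussianAbsMoment * (α r * √(Kker α r r)) :=
    fun r hr => by
      simp only [f]
      rw [integral_const_mul, hX.integral_abs hmt hr]
      ring
  have hν : ∀ᵐ r ∂ν, r ∈ Ioc 1 t := ae_restrict_mem measurableSet_Ioc
  have hcont : ∀ g : ℝ → ℝ, Continuous g → Integrable g ν := fun g hg =>
    (hg.integrableOn_Icc (a := 1) (b := t)).mono_set Ioc_subset_Icc_self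
  have hI : Integrable (Function.uncurry f) (ν.prod P) := by
    refine (integrable_prod_iff hf.aestronglyMeasurable).2 ⟨?_, ?_⟩
    · filter_upwards [hν] with r hr using hint r (by linarith [hr.1])
    · refine (hcont (fun r => gaussianAbsMoment * (α r * √(Kker α r r))) (by fun_prop)).congr ?_
      filter_upwards [hν] with r hr
      rw [← hEf r (by linarith [hr.1])]
      refine integral_congr_ae (ae_of_all _ fun ω => ?_)
      exact (norm_of_nonneg (hf0 r ω)).symm
  have hEY : ∫ ω, Y ω ∂P = gaussianAbsMoment * ∫ r in (1:ℝ)..t, α r * √(Kker α r r) := by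
    have h1 : ∫ ω, Y ω ∂P = ∫ r, ∫ ω, f r ω ∂P ∂ν := by
      have h := integral_prod_symm _ hI
      rw [integral_prod _ hI] at h
      exact h.symm
    rw [h1, intervalIntegral.integral_of_le ht, ← integral_const_mul]
    refine integral_congr_ae ?_
    filter_upwards [hν] with r hr using hEf r (by linarith [hr.1])
  let g : ℝ → ℝ := fun r => gaussianAbsMoment * (α r * √(Kker α r r))
  let D : ℝ × ℝ → ℝ := fun z => α z.1 * α z.2 * Kker α z.1 z.2
  have hg : Integrable g ν := hcont g (by fun_prop)
  have hD : Integrable D (ν.prod ν) := by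
    have hDc : Continuous D := by
      have := continuous_Kker hα
      fun_prop
    have h : IntegrableOn D (Icc 1 t ×ˢ Icc 1 t) (volume.prod volume) :=
      hDc.continuousOn.integrableOn_compact (isCompact_Icc.prod isCompact_Icc)
    have e : ν.prod ν = (volume.prod volume).restrict (Ioc 1 t ×ˢ Ioc 1 t) :=
      Measure.prod_restrict _ _
    rw [e]
    exact h.mono_set (prod_mono Ioc_subset_Icc_self Ioc_subset_Icc_self)
  have hνν : ∀ᵐ z ∂ν.prod ν, z.1 ∈ Ioc 1 t ∧ z.2 ∈ Ioc 1 t := by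
    have e : ν.prod ν = (volume.prod volume).restrict (Ioc 1 t ×ˢ Ioc 1 t) :=
      Measure.prod_restrict _ _
    rw [e]
    exact ae_restrict_mem (measurableSet_Ioc.prod measurableSet_Ioc)
  obtain ⟨hsq, hle⟩ := integrable_sq_integral_and_le (P := P) (ν := ν) hf hf0
    (B := fun z => g z.1 * g z.2 + D z) ((hg.mul_prod hg).add hD)
    (by
      filter_upwards [hνν] with z hz
      have h := hX.hasGaussianLaw_pair hmt (s := z.1) (t := z.2) (by linarith [hz.1.1])
        (by linarith [hz.2.1])
      exact (h.fst.memLp_two.abs.const_mul (α z.1)).integrable_mul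
        (h.snd.memLp_two.abs.const_mul (α z.2)))
    (by
      filter_upwards [hνν] with z hz
      have h := mul_le_mul_of_nonneg_left (hX.integral_abs_mul_abs_le hmt hα (s := z.1) (t := z.2)
        (by linarith [hz.1.1]) (by linarith [hz.2.1])) (mul_pos (hpos z.1) (hpos z.2)).le
      rw [← integral_const_mul] at h
      refine le_trans (le_of_eq ?_) (h.trans (le_of_eq ?_))
      · congr 1; ext ω; simp only [f]; ring
      · simp only [g, D]; ring)
  have hYm : MemLp Y 2 P := (memLp_two_iff_integrable_sq
    hI.integral_prod_right.aestronglyMeasurable).2 hsq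
  rw [hYeq]
  refine ⟨hYm, hEY, ?_⟩
  rw [variance_eq_sub hYm]
  have h1 : ∫ z, (g z.1 * g z.2 + D z) ∂ν.prod ν =
      (∫ ω, Y ω ∂P) ^ 2 + ∫ z, D z ∂ν.prod ν := by
    rw [integral_add (hg.mul_prod hg) hD, integral_prod_mul, hEY, ← sq,
      intervalIntegral.integral_of_le ht, ← integral_const_mul]
  have h2 : ∫ z, D z ∂ν.prod ν ≤ t := by
    refine le_trans (le_of_eq ?_) (integral_integral_mul_Kker_le hα hpos ht)
    rw [integral_prod _ hD]
    simp only [intervalIntegral.integral_of_le ht]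
    rfl
  have h3 : P[Y ^ 2] ≤ ∫ z, (g z.1 * g z.2 + D z) ∂ν.prod ν := hle
  linarith

end Bridge

section Tail

variable {Ω : Type*} [MeasurableSpace Ω] {P : Measure Ω} {α : ℝ → ℝ} {X : ℝ → Ω → ℝ}

lemma IsBridge.exists_tail_bound [IsProbabilityMeasure P] (hX : IsBridge P α X)
    (hm : Measurable (Function.uncurry X)) (hα : Continuous α) (hpos : ∀ t, 0 < α t) {c t₀ : ℝ}
    (hc : 0 < c) (hlb : ∀ t ≥ t₀, c * t ≤ α t) {μ : ℝ} (hμ : μ ≤ 1) (M : ℝ) :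
    ∃ C > 0, ∃ T₀ : ℝ, ∀ t ≥ T₀,
      P {ω | t ^ (-μ) * (∫ r in (1:ℝ)..t, α r * |X r ω|) ≤ M} ≤
        ENNReal.ofReal (C * t ^ (-2:ℝ)) := by
  obtain ⟨κ, hκ, T, hT1, hT⟩ := exists_le_integral_mul_sqrt_Kker hα hpos hc hlb
  set q := gaussianAbsMoment * κ with hq
  have hq0 : 0 < q := mul_pos gaussianAbsMoment_pos hκ
  refine ⟨4 / q ^ 2, by positivity, max T ((2 * M / q) ^ 2), fun t ht => ?_⟩
  have htT : T ≤ t := (le_max_left _ _).trans ht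
  have ht1 : 1 ≤ t := hT1.le.trans htT
  have ht0 : 0 < t := by linarith
  have hst : 0 < √t := sqrt_pos.2 ht0
  have hMt : M ≤ q * √t / 2 := by
    have h : 2 * M / q ≤ √t := le_sqrt_of_sq_le ((le_max_right _ _).trans ht)
    rw [div_le_iff₀ hq0] at h
    linarith
  obtain ⟨hL2, hmean, hvar⟩ := hX.moments_integral_abs hm hα hpos ht1
  set Y : Ω → ℝ := fun ω => ∫ r in (1:ℝ)..t, α r * |X r ω| with hY
  set e := q * (t * √t) / 2 with he
  have he0 : 0 < e := by positivity
  have hEY : 2 * e ≤ P[Y] := by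
    have := mul_le_mul_of_nonneg_left (hT t htT) gaussianAbsMoment_pos.le
    rw [hmean, he, hq]
    linarith
  have hsub : {ω | t ^ (-μ) * Y ω ≤ M} ⊆ {ω | e ≤ |Y ω - P[Y]|} := fun ω hω => by
    have h1 : Y ω ≤ M * t ^ μ := by
      have h := mul_le_mul_of_nonneg_right (show t ^ (-μ) * Y ω ≤ M from hω)
        (rpow_pos_of_pos ht0 μ).le
      rwa [mul_right_comm, ← rpow_add ht0, neg_add_cancel, rpow_zero, one_mul] at h
    have h2 : t ^ μ ≤ t := by
      simpa using rpow_le_rpow_of_exponent_le ht1 hμ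
    have h3 : M * t ^ μ ≤ e := by
      calc M * t ^ μ ≤ (q * √t / 2) * t := by gcongr
        _ = e := by rw [he]; ring
    change e ≤ |Y ω - P[Y]|
    rw [abs_sub_comm]
    exact le_trans (by linarith) (le_abs_self _)
  refine (measure_mono hsub).trans ((meas_ge_le_variance_div_sq hL2 he0).trans ?_)
  refine ENNReal.ofReal_le_ofReal ?_
  calc Var[Y; P] / e ^ 2 ≤ t / e ^ 2 := by gcongr
    _ = 4 / q ^ 2 * t ^ (-2:ℝ) := by
      have : e ^ 2 = q ^ 2 * t ^ 3 / 4 := by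
        rw [he]
        linear_combination (q ^ 2 * t ^ 2 / 4) * sq_sqrt ht0.le
      rw [this, rpow_neg ht0.le, rpow_two]
      field_simp

/-- Borel–Cantelli: summable tail bounds at every level give almost sure divergence. -/
lemma ae_tendsto_atTop_of_tail_bound {Z : ℕ → Ω → ℝ}
    (h : ∀ M > (0:ℝ), ∃ C > (0:ℝ), ∃ ℓ > (1:ℝ), ∃ T₀ : ℝ, ∀ n : ℕ, T₀ ≤ n →
      P {ω | Z n ω ≤ M} ≤ ENNReal.ofReal (C * (n:ℝ) ^ (-ℓ))) :
    ∀ᵐ ω ∂P, Tendsto (fun n => Z n ω) atTop atTop := by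
  have key : ∀ k : ℕ, ∀ᵐ ω ∂P, ∀ᶠ n in atTop, (k:ℝ) ≤ Z n ω := fun k => by
    obtain ⟨C, -, ℓ, hℓ, T₀, hT⟩ := h (k + 1) (by positivity)
    obtain ⟨N, hN⟩ := exists_nat_ge T₀
    have hs : Summable fun n : ℕ => C * ((n + N : ℕ):ℝ) ^ (-ℓ) :=
      ((summable_nat_add_iff N).2 (summable_nat_rpow.2 (by linarith))).mul_left C
    have hne : ∑' n : ℕ, P {ω | Z (n + N) ω ≤ k + 1} ≠ ⊤ :=
      ne_top_of_le_ne_top hs.tsum_ofReal_ne_top (ENNReal.tsum_le_tsum fun n =>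
        hT (n + N) (hN.trans (by exact_mod_cast Nat.le_add_left N n)))
    filter_upwards [ae_eventually_notMem hne] with ω hω
    have hω' : ∀ᶠ n in atTop, (k:ℝ) ≤ Z (n + N) ω := by
      filter_upwards [hω] with n hn
      have : ¬ Z (n + N) ω ≤ k + 1 := hn
      linarith
    filter_upwards [(tendsto_sub_atTop_nat N).eventually hω', eventually_ge_atTop N] with n hn hNn
    rwa [Nat.sub_add_cancel hNn] at hn
  filter_upwards [ae_all_iff.2 key] with ω hω
  refine tendsto_atTop.2 fun b => ?_
  obtain ⟨k, hk⟩ := exists_nat_ge b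
  filter_upwards [hω k] with n hn using hk.trans hn

lemma Aint_comp_max {t : ℝ} (α : ℝ → ℝ) (ht : 0 ≤ t) :
    Aint (fun u => α (max u 0)) t = Aint α t := by
  refine intervalIntegral.integral_congr fun u hu => ?_
  rw [uIcc_of_le ht] at hu
  simp only [max_eq_left hu.1]

lemma Kker_comp_max {s t : ℝ} (α : ℝ → ℝ) (hs : 0 ≤ s) (ht : 0 ≤ t) :
    Kker (fun u => α (max u 0)) s t = Kker α s t := by
  rw [Kker, Kker, Aint_comp_max α hs, Aint_comp_max α ht]
  congr 1
  refine intervalIntegral.integral_congr fun u hu => ?_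
  rw [uIcc_of_le (le_min hs ht)] at hu
  simp only [Aint_comp_max α hu.1]

end Tail

theorem stmt_11 {Ω : Type*} [MeasurableSpace Ω] (P : Measure Ω) [IsProbabilityMeasure P]
    (α : ℝ → ℝ) (X : ℝ → Ω → ℝ)
    (hα_pos : ∀ t ≥ (0:ℝ), 0 < α t)
    (hα_cont : ContinuousOn α (Set.Ici 0))
    (hgrowth : ∃ γ β : ℝ, GrowthCond α γ β)
    (c t₀ ρ : ℝ) (hc : 0 < c) (ht₀ : 0 < t₀) (hρ : 1 < ρ)
    (hlb : ∀ t ≥ t₀, c * t ^ ρ ≤ α t)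
    (hX : IsBridge P α X)
    (hmeas : Measurable (Function.uncurry X)) :
    ∀ μ : ℝ, 0 < μ → μ < min (ρ/2) 1 →
      (∀ M > (0:ℝ), ∃ C > (0:ℝ), ∃ ℓ > (1:ℝ), ∃ T₀ : ℝ, ∀ t ≥ T₀,
        P {ω | t ^ (-μ) * (∫ r in (1:ℝ)..t, α r * |X r ω|) ≤ M} ≤
          ENNReal.ofReal (C * t ^ (-ℓ))) ∧
      (∀ᵐ ω ∂P, Tendsto (fun n : ℕ =>
          (n:ℝ) ^ (-μ) * ∫ r in (1:ℝ)..(n:ℝ), α r * |X r ω|) atTop atTop) := by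
  intro μ _ hμ
  have hμ1 : μ ≤ 1 := hμ.le.trans (min_le_right _ _)
  set α' : ℝ → ℝ := fun u => α (max u 0) with hα'
  have hcont : Continuous α' :=
    hα_cont.comp_continuous (by fun_prop) fun u => le_max_right u 0
  have hpos : ∀ t, 0 < α' t := fun t => hα_pos _ (le_max_right t 0)
  have hX' : IsBridge P α' X :=
    ⟨hX.1, fun s t hs ht => by rw [hX.2 s t hs ht, hα', Kker_comp_max α hs ht]⟩
  have hlb' : ∀ t ≥ max t₀ 1, c * t ≤ α' t := fun t ht => by
    have h1 : 1 ≤ t := (le_max_right _ _).trans ht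
    have h2 : t ≤ t ^ ρ := by simpa using rpow_le_rpow_of_exponent_le h1 hρ.le
    simp only [hα', max_eq_left (zero_le_one.trans h1)]
    exact (mul_le_mul_of_nonneg_left h2 hc.le).trans (hlb t ((le_max_left _ _).trans ht))
  have htail : ∀ M > (0:ℝ), ∃ C > (0:ℝ), ∃ ℓ > (1:ℝ), ∃ T₀ : ℝ, ∀ t ≥ T₀,
      P {ω | t ^ (-μ) * (∫ r in (1:ℝ)..t, α r * |X r ω|) ≤ M} ≤
        ENNReal.ofReal (C * t ^ (-ℓ)) := fun M _ => by
    obtain ⟨C, hC, T₀, hT⟩ := hX'.exists_tail_bound hmeas hcont hpos hc hlb' hμ1 M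
    refine ⟨C, hC, 2, by norm_num, max T₀ 1, fun t ht => ?_⟩
    have ht1 : 1 ≤ t := (le_max_right _ _).trans ht
    convert hT t ((le_max_left _ _).trans ht) using 6 with ω
    refine intervalIntegral.integral_congr fun r hr => ?_
    rw [uIcc_of_le ht1] at hr
    simp only [hα', max_eq_left (zero_le_one.trans hr.1)]
  refine ⟨htail, ae_tendsto_atTop_of_tail_bound fun M hM => ?_⟩
  obtain ⟨C, hC, ℓ, hℓ, T₀, hT⟩ := htail M hM
  exact ⟨C, hC, ℓ, hℓ, T₀, fun n hn => hT n hn⟩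
end

section
/- Let α : [0,∞) → (0,∞) be continuous, let K be the associated covariance kernel, let p ≥ 1 be an integer, let 0 < u₁ < u₂ < ⋯ < u_p < ∞, set u₀ = 0, and let A_p(u) = (K(u_i,u_j))_{1≤i,j≤p}, which is invertible. Then the diagonal entries of the inverse matrix satisfy: for 1 ≤ i ≤ p − 1, (A_p(u)^{−1})_{ii} ≤ exp(2 α*(u_p) u_p) · [ (u_{i+1} − u_i)^{−1} + (u_i − u_{i−1})^{−1} ], and for i = p, (A_p(u)^{−1})_{pp} ≤ exp(2 α*(u_p) u_p) · (u_p − u_{p−1})^{−1}. -/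
open MeasureTheory ProbabilityTheory Real Filter Set

/-- A one-pair matrix `a i⁻¹ * a j⁻¹ * F (min i j + 1)` with `F 0 = 0` and distinct consecutive
values of `F` has an explicit tridiagonal inverse, whose diagonal is given here. -/
theorem isUnit_det_and_inv_diag_of_onePair (p : ℕ) (a F : ℕ → ℝ) (ha : ∀ k, a k ≠ 0)
    (hF0 : F 0 = 0) (hF : ∀ k < p, F (k + 1) - F k ≠ 0) (M : Matrix (Fin p) (Fin p) ℝ)
    (hM : ∀ i j : Fin p, M i j = (a i)⁻¹ * (a j)⁻¹ * F (min (i : ℕ) j + 1)) :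
    IsUnit M.det ∧ ∀ i : Fin p, M⁻¹ i i =
      a i ^ 2 * ((F (i + 1) - F i)⁻¹ + if (i : ℕ) + 1 < p then (F (i + 2) - F (i + 1))⁻¹ else 0) := by
  let w : Fin p → ℝ := fun k => F (k + 1) - F k
  let R : Matrix (Fin p) (Fin p) ℝ := Matrix.of fun i k => if (k : ℕ) ≤ i then (a i)⁻¹ else 0
  let Q : Matrix (Fin p) (Fin p) ℝ := Matrix.of fun k i =>
    (if k = i then a i else 0) - (if (k : ℕ) = i + 1 then a i else 0)
  have sum_succ (f : ℕ → ℝ) (i : Fin p) :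
      (∑ k : Fin p, if (k : ℕ) = i + 1 then f k else 0)
        = if (i : ℕ) + 1 < p then f (i + 1) else 0 := by
    rw [Fin.sum_univ_eq_sum_range (fun k => if k = (i : ℕ) + 1 then f k else 0) p,
      Finset.sum_ite_eq']
    simp
  have hRQ : R * Q = 1 := by
    ext i j
    have h1 := sum_succ (fun k => if k ≤ (i : ℕ) then (a i)⁻¹ * a j else 0) j
    simp only [Matrix.mul_apply, R, Q, Matrix.of_apply, mul_sub, Finset.sum_sub_distrib]
    have h2 : ∀ k : Fin p, (if (k : ℕ) ≤ i then (a i)⁻¹ else 0) *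
        (if (k : ℕ) = j + 1 then a j else 0) =
        if (k : ℕ) = j + 1 then (if (k : ℕ) ≤ (i : ℕ) then (a i)⁻¹ * a j else 0) else 0 := by
      intro k; split_ifs <;> simp
    simp only [h2, h1]
    simp only [mul_ite, mul_zero, Finset.sum_ite_eq', Finset.mem_univ, if_true]
    rw [Matrix.one_apply]
    have hi := i.2
    have := ha j
    rcases lt_trichotomy i j with h | h | h
    · have : (i : ℕ) < j := h
      rw [if_neg (by omega), if_neg (by omega : ¬ (j : ℕ) + 1 ≤ i), if_neg h.ne]
      simp
    · subst h
      simp [ha]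
    · have : (j : ℕ) < i := h
      rw [if_pos (by omega), if_pos (by omega : (j : ℕ) + 1 ≤ i), if_pos (by omega), if_neg h.ne']
      simp
  have hQR : Q * R = 1 := mul_eq_one_comm.mp hRQ
  have hMR : M = R * Matrix.diagonal w * R.transpose := by
    ext i j
    rw [hM, Matrix.mul_apply]
    simp only [Matrix.mul_diagonal, Matrix.transpose_apply, R, Matrix.of_apply, w]
    have h1 : ∀ k : Fin p, (if (k : ℕ) ≤ i then (a i)⁻¹ else 0) * (F (k + 1) - F k) *
        (if (k : ℕ) ≤ j then (a j)⁻¹ else 0) = (a i)⁻¹ * (a j)⁻¹ *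
          (fun k : ℕ => if k < min (i : ℕ) j + 1 then F (k + 1) - F k else 0) k := by
      intro k
      have : (k : ℕ) < min (i : ℕ) j + 1 ↔ (k : ℕ) ≤ i ∧ (k : ℕ) ≤ j := by omega
      simp only [this]
      by_cases hi : (k : ℕ) ≤ i <;> by_cases hj : (k : ℕ) ≤ j <;> simp [hi, hj]
      ring
    simp only [h1, ← Finset.mul_sum]
    congr 1
    rw [Fin.sum_univ_eq_sum_range
      (fun k : ℕ => if k < min (i : ℕ) j + 1 then F (k + 1) - F k else 0) p, ← Finset.sum_filter]
    have h2 : (Finset.range p).filter (fun k => k < min (i : ℕ) j + 1)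
        = Finset.range (min (i : ℕ) j + 1) := by
      ext k
      have := i.2
      simp only [Finset.mem_filter, Finset.mem_range]
      omega
    rw [h2, Finset.sum_range_sub, hF0, sub_zero]
  have hw : Matrix.diagonal w * Matrix.diagonal (fun k => (w k)⁻¹) = 1 := by
    rw [Matrix.diagonal_mul_diagonal, ← Matrix.diagonal_one]
    congr 1
    ext k
    exact mul_inv_cancel₀ (hF k k.2)
  have hMN : M * (Q.transpose * Matrix.diagonal (fun k => (w k)⁻¹) * Q) = 1 := by
    calc M * (Q.transpose * Matrix.diagonal (fun k => (w k)⁻¹) * Q)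
        = R * (Matrix.diagonal w * ((Q * R).transpose * Matrix.diagonal (fun k => (w k)⁻¹))) * Q := by
          rw [hMR, Matrix.transpose_mul]; simp only [Matrix.mul_assoc]
      _ = 1 := by rw [hQR, Matrix.transpose_one, Matrix.one_mul, hw, Matrix.mul_one, hRQ]
  refine ⟨(Matrix.isUnit_iff_isUnit_det M).mp (IsUnit.of_mul_eq_one _ hMN), fun i => ?_⟩
  rw [Matrix.inv_eq_right_inv hMN, Matrix.mul_apply]
  simp only [Matrix.mul_diagonal, Matrix.transpose_apply, Q, Matrix.of_apply, w]
  have h1 : ∀ k : Fin p, ((if k = i then a i else 0) - (if (k : ℕ) = i + 1 then a i else 0)) *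
      (F (k + 1) - F k)⁻¹ * ((if k = i then a i else 0) - (if (k : ℕ) = i + 1 then a i else 0)) =
      (if k = i then a i ^ 2 * (F (i + 1) - F i)⁻¹ else 0) +
      (if (k : ℕ) = i + 1 then a i ^ 2 * (F (k + 1) - F k)⁻¹ else 0) := by
    intro k
    by_cases h : k = i
    · subst h; simp; ring
    · simp only [h, if_false]
      split_ifs <;> ring
  simp only [h1, Finset.sum_add_distrib]
  rw [sum_succ (fun k => a i ^ 2 * (F (k + 1) - F k)⁻¹) i]
  simp only [Finset.sum_ite_eq', Finset.mem_univ, if_true, mul_add, mul_ite, mul_zero]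

theorem intervalIntegrable_of_continuousOn_Ici {α : ℝ → ℝ} (hα : ContinuousOn α (Ici 0))
    {s t : ℝ} (hs : 0 ≤ s) (ht : 0 ≤ t) : IntervalIntegrable α volume s t :=
  (hα.mono fun _ hx => (le_min hs ht).trans hx.1).intervalIntegrable

theorem Aint_monotoneOn {α : ℝ → ℝ} (hpos : ∀ t ≥ (0:ℝ), 0 < α t)
    (hα : ContinuousOn α (Ici 0)) : MonotoneOn (Aint α) (Ici 0) := by
  intro s hs t ht hst
  have h := intervalIntegral.integral_interval_sub_left
    (intervalIntegrable_of_continuousOn_Ici hα le_rfl ht)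
    (intervalIntegrable_of_continuousOn_Ici hα le_rfl hs)
  have h' : 0 ≤ ∫ x in s..t, α x :=
    intervalIntegral.integral_nonneg hst fun x hx => (hpos x (le_trans hs hx.1)).le
  unfold Aint
  linarith

theorem Aint_nonneg {α : ℝ → ℝ} (hpos : ∀ t ≥ (0:ℝ), 0 < α t) {t : ℝ} (ht : 0 ≤ t) :
    0 ≤ Aint α t :=
  intervalIntegral.integral_nonneg ht fun x hx => (hpos x hx.1).le

theorem Aint_le_alphaStar_mul {α : ℝ → ℝ} (hpos : ∀ t ≥ (0:ℝ), 0 < α t)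
    (hα : ContinuousOn α (Ici 0)) {t T : ℝ} (ht : 0 ≤ t) (htT : t ≤ T) :
    Aint α t ≤ alphaStar α T * T := by
  have hT := ht.trans htT
  refine (Aint_monotoneOn hpos hα ht hT htT).trans ?_
  have hb : BddAbove (α '' Icc 0 T) :=
    (isCompact_Icc.image_of_continuousOn (hα.mono fun _ hx => hx.1)).bddAbove
  calc Aint α T ≤ ∫ _ in (0:ℝ)..T, alphaStar α T :=
        intervalIntegral.integral_mono_on hT (intervalIntegrable_of_continuousOn_Ici hα le_rfl hT)
          intervalIntegrable_const fun x hx => le_csSup hb (mem_image_of_mem α hx)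
    _ = alphaStar α T * T := by rw [intervalIntegral.integral_const, smul_eq_mul]; ring

theorem sub_le_integral_exp_Aint_sub {α : ℝ → ℝ} (hpos : ∀ t ≥ (0:ℝ), 0 < α t)
    (hα : ContinuousOn α (Ici 0)) {s t : ℝ} (hs : 0 ≤ s) (hst : s ≤ t) :
    t - s ≤ (∫ x in (0:ℝ)..t, exp (2 * Aint α x)) - ∫ x in (0:ℝ)..s, exp (2 * Aint α x) := by
  have hi : ∀ a b : ℝ, 0 ≤ a → 0 ≤ b →
      IntervalIntegrable (fun x => exp (2 * Aint α x)) volume a b := by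
    intro a b ha hb
    refine MonotoneOn.intervalIntegrable fun x hx y hy hxy => ?_
    have hm := Aint_monotoneOn hpos hα ((le_min ha hb).trans hx.1) ((le_min ha hb).trans hy.1) hxy
    exact exp_le_exp.mpr (by linarith)
  rw [intervalIntegral.integral_interval_sub_left (hi 0 t le_rfl (hs.trans hst))
    (hi 0 s le_rfl hs)]
  calc t - s = ∫ _ in s..t, (1:ℝ) := by simp
    _ ≤ _ := intervalIntegral.integral_mono_on hst intervalIntegrable_const
        (hi s t hs (hs.trans hst)) fun x hx =>
          one_le_exp (by linarith [Aint_nonneg hpos (hs.trans hx.1)])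

theorem stmt_15 (α : ℝ → ℝ)
    (hα_pos : ∀ t ≥ (0:ℝ), 0 < α t)
    (hα_cont : ContinuousOn α (Set.Ici 0))
    (p : ℕ) (hp : 0 < p) (u : ℕ → ℝ)
    (hu0 : u 0 = 0) (hu1 : 0 < u 1)
    (hmono : ∀ i : ℕ, 1 ≤ i → i < p → u i < u (i+1)) :
    IsUnit (Matrix.of fun i j : Fin p => Kker α (u ((i:ℕ)+1)) (u ((j:ℕ)+1))).det ∧
    ∀ i : Fin p,
      ((i:ℕ) + 1 < p →
        (Matrix.of fun i j : Fin p => Kker α (u ((i:ℕ)+1)) (u ((j:ℕ)+1)))⁻¹ i i ≤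
          Real.exp (2 * alphaStar α (u p) * u p) *
            ((u ((i:ℕ)+2) - u ((i:ℕ)+1))⁻¹ + (u ((i:ℕ)+1) - u (i:ℕ))⁻¹)) ∧
      ((i:ℕ) + 1 = p →
        (Matrix.of fun i j : Fin p => Kker α (u ((i:ℕ)+1)) (u ((j:ℕ)+1)))⁻¹ i i ≤
          Real.exp (2 * alphaStar α (u p) * u p) * (u p - u (p-1))⁻¹) := by
  have hstep : ∀ k < p, u k < u (k + 1) := by
    intro k hk
    rcases Nat.eq_zero_or_pos k with rfl | h
    · simpa [hu0] using hu1
    · exact hmono k h hk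
  have hle : ∀ m ≤ p, ∀ k ≤ m, u k ≤ u m := by
    intro m
    induction m with
    | zero => intro _ k hk; rw [Nat.le_zero.mp hk]
    | succ m ih =>
      intro hm k hk
      rcases Nat.le_succ_iff.mp hk with h | h
      · exact (ih (by omega) k h).trans (hstep m (by omega)).le
      · rw [h]
  have hnn : ∀ k ≤ p, 0 ≤ u k := fun k hk => hu0 ▸ hle k hk 0 (Nat.zero_le _)
  let F : ℕ → ℝ := fun k => ∫ x in (0:ℝ)..u k, exp (2 * Aint α x)
  have hF : ∀ k < p, u (k + 1) - u k ≤ F (k + 1) - F k := fun k hk =>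
    sub_le_integral_exp_Aint_sub hα_pos hα_cont (hnn k hk.le) (hstep k hk).le
  have hinv : ∀ k < p, (F (k + 1) - F k)⁻¹ ≤ (u (k + 1) - u k)⁻¹ := fun k hk =>
    inv_anti₀ (sub_pos.mpr (hstep k hk)) (hF k hk)
  have hexp : ∀ k < p, exp (Aint α (u (k + 1))) ^ 2 ≤ exp (2 * alphaStar α (u p) * u p) := by
    intro k hk
    rw [← exp_nat_mul]
    have := Aint_le_alphaStar_mul hα_pos hα_cont (hnn (k + 1) hk) (hle p le_rfl (k + 1) hk)
    exact exp_le_exp.mpr (by push_cast; linarith)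
  obtain ⟨hdet, hdiag⟩ := isUnit_det_and_inv_diag_of_onePair p
    (fun k => exp (Aint α (u (k + 1)))) F (fun k => (exp_pos _).ne') (by simp [F, hu0])
    (fun k hk => ((sub_pos.mpr (hstep k hk)).trans_le (hF k hk)).ne')
    (Matrix.of fun i j : Fin p => Kker α (u ((i:ℕ)+1)) (u ((j:ℕ)+1))) (by
      intro i j
      have hmin : min (u ((i:ℕ)+1)) (u ((j:ℕ)+1)) = u (min (i:ℕ) j + 1) := by
        rcases le_total (i:ℕ) j with h | h
        · rw [min_eq_left h, min_eq_left (hle _ j.2 _ (by omega))]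
        · rw [min_eq_right h, min_eq_right (hle _ i.2 _ (by omega))]
      simp only [Matrix.of_apply, Kker, F, hmin, ← exp_neg, ← exp_add, sub_eq_add_neg])
  refine ⟨hdet, fun i => ⟨fun hi => ?_, fun hi => ?_⟩⟩
  · rw [hdiag i, if_pos hi, add_comm (F (i + 1) - F i)⁻¹]
    have h1 := inv_nonneg.mpr (sub_pos.mpr (hstep i i.2)).le
    have h2 := inv_nonneg.mpr (sub_pos.mpr (hstep (i + 1) hi)).le
    refine (mul_le_mul_of_nonneg_left (add_le_add (hinv (i + 1) hi) (hinv i i.2))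
      (sq_nonneg _)).trans ?_
    exact mul_le_mul_of_nonneg_right (hexp i i.2) (add_nonneg h2 h1)
  · rw [hdiag i, if_neg (by omega), add_zero]
    have hp1 : p - 1 = i := by omega
    have h1 := inv_nonneg.mpr (sub_pos.mpr (hstep i i.2)).le
    rw [hp1, show u p - u i = u (i + 1) - u i by rw [hi]]
    exact (mul_le_mul_of_nonneg_left (hinv i i.2) (sq_nonneg _)).trans
      (mul_le_mul_of_nonneg_right (hexp i i.2) h1)
end
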